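/- Let r > 2 and let Γ = (0,1)² \ (S₁((0,1)²) ∪ S₂((0,1)²) ∪ S₃((0,1)²) ∪ S₄((0,1)²)). Then for every ε with 0 < ε < (r−2)/(2r), the following recursion holds: λ²((C^r)_{ε/r} ∩ Γ) = (2/r²) · λ²((C^r)_ε ∩ Γ) + (3π/r²) · ε². -/

import Mathlib

open MeasureTheory Metric Set Real Filter Topology ENNReal

/-- The similarity map `x ↦ x/r + (a, b)` of the plane. -/
noncomputable def cantorMap (r a b : ℝ) (x : EuclideanSpace ℝ (Fin 2)) :
    EuclideanSpace ℝ (Fin 2) :=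
  r⁻¹ • x + (WithLp.equiv 2 (Fin 2 → ℝ)).symm ![a, b]

/-- `C` is the Cantor dust with parameter `r`: the (unique) nonempty compact set invariant
under the four similarities `S₁, S₂, S₃, S₄`. -/
def IsCantorDust (r : ℝ) (C : Set (EuclideanSpace ℝ (Fin 2))) : Prop :=
  IsCompact C ∧ C.Nonempty ∧
    C = cantorMap r 0 0 '' C ∪ cantorMap r ((r - 1) / r) 0 '' C ∪
        cantorMap r ((r - 1) / r) ((r - 1) / r) '' C ∪ cantorMap r 0 ((r - 1) / r) '' C

/-- The open unit square `(0,1)²`. -/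
def openSquare : Set (EuclideanSpace ℝ (Fin 2)) :=
  {x | 0 < x 0 ∧ x 0 < 1 ∧ 0 < x 1 ∧ x 1 < 1}

/-- `Γ = (0,1)² \ (S₁((0,1)²) ∪ S₂((0,1)²) ∪ S₃((0,1)²) ∪ S₄((0,1)²))`. -/
noncomputable def Gamma (r : ℝ) : Set (EuclideanSpace ℝ (Fin 2)) :=
  openSquare \
    (cantorMap r 0 0 '' openSquare ∪ cantorMap r ((r - 1) / r) 0 '' openSquare ∪
     cantorMap r ((r - 1) / r) ((r - 1) / r) '' openSquare ∪
     cantorMap r 0 ((r - 1) / r) '' openSquare)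

theorem subset_of_contracting_cover {X : Type*} [MetricSpace X] {A C : Set X} {q : ℝ}
    (hq : 0 ≤ q) (hq' : q < 1) (hA : Bornology.IsBounded A) (hC : IsCompact C)
    (hne : C.Nonempty)
    (h : ∀ p ∈ A, ∃ S : X → X, MapsTo S C C ∧ (∀ x y, dist (S x) (S y) ≤ q * dist x y) ∧
      ∃ p' ∈ A, S p' = p) : A ⊆ C := by
  obtain ⟨c₀, hc₀⟩ := hne
  obtain ⟨B, hB⟩ := (isBounded_iff_subset_closedBall c₀).1 hA
  have key : ∀ n : ℕ, ∀ p ∈ A, infDist p C ≤ q ^ n * B := by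
    intro n
    induction n with
    | zero =>
      intro p hp
      simpa using (infDist_le_dist_of_mem hc₀).trans (mem_closedBall.1 (hB hp))
    | succ n ih =>
      intro p hp
      obtain ⟨S, hS, hd, p', hp', rfl⟩ := h p hp
      obtain ⟨c, hc, hpc⟩ := hC.exists_infDist_eq_dist ⟨c₀, hc₀⟩ p'
      calc infDist (S p') C ≤ dist (S p') (S c) := infDist_le_dist_of_mem (hS hc)
        _ ≤ q * dist p' c := hd _ _
        _ ≤ q * (q ^ n * B) := by
          rw [← hpc]
          exact mul_le_mul_of_nonneg_left (ih p' hp') hq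
        _ = q ^ (n + 1) * B := by ring
  intro p hp
  have hlim : Tendsto (fun n : ℕ => q ^ n * B) atTop (𝓝 0) := by
    simpa using (tendsto_pow_atTop_nhds_zero_of_lt_one hq hq').mul_const B
  have h0 : infDist p C ≤ 0 := ge_of_tendsto' hlim fun n => key n p hp
  exact (hC.isClosed.mem_iff_infDist_zero ⟨c₀, hc₀⟩).2 (le_antisymm h0 infDist_nonneg)

@[simp] theorem cantorMap_apply_zero (r a b : ℝ) (x : EuclideanSpace ℝ (Fin 2)) :
    cantorMap r a b x 0 = r⁻¹ * x 0 + a := by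
  simp [cantorMap]

@[simp] theorem cantorMap_apply_one (r a b : ℝ) (x : EuclideanSpace ℝ (Fin 2)) :
    cantorMap r a b x 1 = r⁻¹ * x 1 + b := by
  simp [cantorMap]

theorem dist_cantorMap {r : ℝ} (hr : 0 < r) (a b : ℝ) (x y : EuclideanSpace ℝ (Fin 2)) :
    dist (cantorMap r a b x) (cantorMap r a b y) = r⁻¹ * dist x y := by
  simp [cantorMap, dist_smul₀, abs_of_pos hr]

theorem euclideanSpace_two_ext {p q : EuclideanSpace ℝ (Fin 2)} (h₀ : p 0 = q 0)
    (h₁ : p 1 = q 1) : p = q := by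
  ext i
  fin_cases i
  · exact h₀
  · exact h₁

theorem dist_sq_euclideanSpace_two (p q : EuclideanSpace ℝ (Fin 2)) :
    dist p q ^ 2 = dist (p 0) (q 0) ^ 2 + dist (p 1) (q 1) ^ 2 := by
  rw [EuclideanSpace.dist_eq, Real.sq_sqrt (by positivity), Fin.sum_univ_two]

/-- `M` is the middle Cantor set of ratio `1 / r`: the nonempty compact subset of the line
invariant under `x ↦ x / r` and `x ↦ (x + (r - 1)) / r`. -/
structure IsCantorLine (r : ℝ) (M : Set ℝ) : Prop where
  isCompact : IsCompact M
  nonempty : M.Nonempty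
  left_mem : ∀ {x}, x ∈ M → x / r ∈ M
  right_mem : ∀ {x}, x ∈ M → (x + (r - 1)) / r ∈ M
  exists_preimage : ∀ {x}, x ∈ M → ∃ y ∈ M, x = y / r ∨ x = (y + (r - 1)) / r

theorem IsCantorDust.exists_cantorLine {r : ℝ} (hr : 2 < r) {C : Set (EuclideanSpace ℝ (Fin 2))}
    (hC : IsCantorDust r C) :
    ∃ M, IsCantorLine r M ∧ ∀ p, p ∈ C ↔ p 0 ∈ M ∧ p 1 ∈ M := by
  obtain ⟨hK, hne, heq⟩ := hC
  have hr0 : 0 < r := by linarith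
  have maps : ∀ a b, (a = 0 ∨ a = (r - 1) / r) → (b = 0 ∨ b = (r - 1) / r) →
      ∀ p ∈ C, cantorMap r a b p ∈ C := by
    intro a b ha hb p hp
    rw [heq]
    have := mem_image_of_mem (cantorMap r a b) hp
    rcases ha with rfl | rfl <;> rcases hb with rfl | rfl <;> simp only [mem_union, this] <;> simp
  have cover : ∀ p ∈ C, ∃ a b, (a = 0 ∨ a = (r - 1) / r) ∧ (b = 0 ∨ b = (r - 1) / r) ∧
      ∃ q ∈ C, cantorMap r a b q = p := by
    intro p hp
    rw [heq] at hp
    rcases hp with ((h | h) | h) | h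
    · exact ⟨0, 0, .inl rfl, .inl rfl, h⟩
    · exact ⟨_, 0, .inr rfl, .inl rfl, h⟩
    · exact ⟨_, _, .inr rfl, .inr rfl, h⟩
    · exact ⟨0, _, .inl rfl, .inr rfl, h⟩
  set M : Set ℝ := (fun p : EuclideanSpace ℝ (Fin 2) => p 0) '' C ∪ (fun p => p 1) '' C with hM
  have hMc : IsCompact M := (hK.image (by fun_prop)).union (hK.image (by fun_prop))
  have pre : ∀ x ∈ M, ∃ a, (a = 0 ∨ a = (r - 1) / r) ∧ ∃ y ∈ M, r⁻¹ * y + a = x := by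
    rintro x (⟨p, hp, rfl⟩ | ⟨p, hp, rfl⟩) <;>
      obtain ⟨a, b, ha, hb, q, hq, rfl⟩ := cover p hp
    · exact ⟨a, ha, q 0, .inl ⟨q, hq, rfl⟩, by simp⟩
    · exact ⟨b, hb, q 1, .inr ⟨q, hq, rfl⟩, by simp⟩
  have img : ∀ a, (a = 0 ∨ a = (r - 1) / r) → ∀ x ∈ M, r⁻¹ * x + a ∈ M := by
    rintro a ha x (⟨p, hp, rfl⟩ | ⟨p, hp, rfl⟩)
    · exact .inl ⟨_, maps a a ha ha p hp, by simp⟩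
    · exact .inr ⟨_, maps a a ha ha p hp, by simp⟩
  have hsub : {p : EuclideanSpace ℝ (Fin 2) | p 0 ∈ M ∧ p 1 ∈ M} ⊆ C := by
    refine subset_of_contracting_cover (q := r⁻¹) (by positivity)
      (inv_lt_one_of_one_lt₀ (by linarith)) ?_ hK hne ?_
    · obtain ⟨B, hB⟩ := hMc.isBounded.exists_norm_le
      refine isBounded_iff_forall_norm_le.2 ⟨√(B ^ 2 + B ^ 2), fun p hp => ?_⟩
      rw [EuclideanSpace.norm_eq, Fin.sum_univ_two]
      have h0 := hB _ hp.1
      have h1 := hB _ hp.2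
      gcongr
    · rintro p ⟨h0, h1⟩
      obtain ⟨a, ha, x, hx, hxp⟩ := pre _ h0
      obtain ⟨b, hb, y, hy, hyp⟩ := pre _ h1
      refine ⟨cantorMap r a b, maps a b ha hb, fun x y => (dist_cantorMap hr0 a b x y).le,
        !₂[x, y], ⟨hx, hy⟩, ?_⟩
      apply euclideanSpace_two_ext <;> simp [hxp, hyp]
  refine ⟨M, ⟨hMc, ?_, ?_, ?_, ?_⟩, fun p => ⟨fun hp => ⟨.inl ⟨p, hp, rfl⟩, .inr ⟨p, hp, rfl⟩⟩,
    fun hp => hsub hp⟩⟩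
  · obtain ⟨p, hp⟩ := hne
    exact ⟨p 0, .inl ⟨p, hp, rfl⟩⟩
  · intro x hx
    convert img 0 (.inl rfl) x hx using 1
    ring
  · intro x hx
    convert img _ (.inr rfl) x hx using 1
    ring
  · intro x hx
    obtain ⟨a, rfl | rfl, y, hy, rfl⟩ := pre x hx
    · exact ⟨y, hy, .inl (by ring)⟩
    · exact ⟨y, hy, .inr (by ring)⟩

theorem mem_cthickening_of_forall_mem_iff {C : Set (EuclideanSpace ℝ (Fin 2))} {M : Set ℝ}
    (hM : IsCompact M) (hne : M.Nonempty) (hC : IsCompact C)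
    (h : ∀ p, p ∈ C ↔ p 0 ∈ M ∧ p 1 ∈ M) {δ : ℝ} (hδ : 0 ≤ δ) (p : EuclideanSpace ℝ (Fin 2)) :
    p ∈ cthickening δ C ↔ infDist (p 0) M ^ 2 + infDist (p 1) M ^ 2 ≤ δ ^ 2 := by
  rw [hC.cthickening_eq_biUnion_closedBall hδ]
  simp only [mem_iUnion, mem_closedBall, exists_prop]
  constructor
  · rintro ⟨c, hc, hd⟩
    have h2 : dist p c ^ 2 ≤ δ ^ 2 := by gcongr
    rw [dist_sq_euclideanSpace_two] at h2
    refine le_trans ?_ h2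
    obtain ⟨h0, h1⟩ := (h c).1 hc
    gcongr <;> first | exact infDist_nonneg | exact infDist_le_dist_of_mem ‹_›
  · intro hp
    obtain ⟨x, hx, hx'⟩ := hM.exists_infDist_eq_dist hne (p 0)
    obtain ⟨y, hy, hy'⟩ := hM.exists_infDist_eq_dist hne (p 1)
    refine ⟨!₂[x, y], (h _).2 ⟨hx, hy⟩, ?_⟩
    rw [hx', hy'] at hp
    refine abs_le_of_sq_le_sq' ?_ hδ |>.2
    rw [dist_sq_euclideanSpace_two]
    exact hp

theorem mem_image_cantorMap_openSquare {r : ℝ} (hr : 0 < r) (a b : ℝ)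
    (p : EuclideanSpace ℝ (Fin 2)) :
    p ∈ cantorMap r a b '' openSquare ↔
      (a < p 0 ∧ p 0 < a + 1 / r) ∧ b < p 1 ∧ p 1 < b + 1 / r := by
  constructor
  · rintro ⟨q, ⟨h1, h2, h3, h4⟩, rfl⟩
    have hi : 0 < r⁻¹ := by positivity
    simp only [cantorMap_apply_zero, cantorMap_apply_one, one_div]
    refine ⟨⟨?_, ?_⟩, ?_, ?_⟩ <;> nlinarith
  · rintro ⟨⟨h1, h2⟩, h3, h4⟩
    refine ⟨!₂[r * (p 0 - a), r * (p 1 - b)], ?_, ?_⟩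
    · have e : r * (1 / r) = 1 := by field_simp
      simp only [openSquare, mem_ofPred_eq]
      refine ⟨?_, ?_, ?_, ?_⟩ <;> simp <;> nlinarith
    · apply euclideanSpace_two_ext <;> simp <;> field_simp <;> ring

theorem mem_Gamma_iff {r : ℝ} (hr : 2 < r) (p : EuclideanSpace ℝ (Fin 2)) :
    p ∈ _root_.Gamma r ↔ (p 0 ∈ Icc (1 / r) (1 - 1 / r) ∧ p 1 ∈ Ioo 0 1) ∨
      (p 1 ∈ Icc (1 / r) (1 - 1 / r) ∧ p 0 ∈ Ioo 0 1) := by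
  have hr0 : 0 < r := by linarith
  have hi : 0 < 1 / r := by positivity
  have e : (r - 1) / r = 1 - 1 / r := by field_simp
  simp only [_root_.Gamma, Set.mem_sdiff, mem_union, mem_image_cantorMap_openSquare hr0, e]
  simp only [openSquare, mem_ofPred_eq, mem_Icc, mem_Ioo]
  clear e
  generalize 1 / r = s at *
  grind

theorem dist_div_div {r : ℝ} (hr : 0 < r) (u v : ℝ) : dist (u / r) (v / r) = dist u v / r := by
  rw [Real.dist_eq, Real.dist_eq, ← sub_div, abs_div, abs_of_pos hr]

theorem integral_sqrt_sq_sub_sq {δ c : ℝ} (hδ : 0 < δ) (hc : δ ≤ c) :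
    ∫ t in (-c)..c, 2 * √(δ ^ 2 - t ^ 2) = π * δ ^ 2 := by
  have hint : ∀ a b : ℝ, IntervalIntegrable (fun t : ℝ => 2 * √(δ ^ 2 - t ^ 2)) volume a b :=
    fun a b => Continuous.intervalIntegrable (by fun_prop) a b
  have hzero : ∀ a b : ℝ, (∀ t ∈ uIcc a b, δ ^ 2 ≤ t ^ 2) →
      ∫ t in a..b, 2 * √(δ ^ 2 - t ^ 2) = 0 := fun a b h => by
    rw [intervalIntegral.integral_congr (g := fun _ => (0 : ℝ))]
    · simp
    · intro t ht
      simp [Real.sqrt_eq_zero_of_nonpos (sub_nonpos.2 (h t ht))]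
  rw [← intervalIntegral.integral_add_adjacent_intervals (hint (-c) (-δ)) (hint _ _),
    ← intervalIntegral.integral_add_adjacent_intervals (hint (-δ) δ) (hint _ _),
    hzero (-c) (-δ), hzero δ c]
  · have hsc := intervalIntegral.integral_comp_mul_left
      (fun t : ℝ => 2 * √(δ ^ 2 - t ^ 2)) (a := -1) (b := 1) hδ.ne'
    have hf : ∀ s : ℝ, 2 * √(δ ^ 2 - (δ * s) ^ 2) = 2 * δ * √(1 - s ^ 2) := fun s => by
      rw [show δ ^ 2 - (δ * s) ^ 2 = δ ^ 2 * (1 - s ^ 2) by ring,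
        Real.sqrt_mul (sq_nonneg δ), Real.sqrt_sq hδ.le]
      ring
    simp only [hf, intervalIntegral.integral_const_mul, integral_sqrt_one_sub_sq, mul_neg, mul_one,
      smul_eq_mul] at hsc
    rw [intervalIntegral.integral_const_mul]
    field_simp at hsc
    linarith
  · intro t ht
    rw [uIcc_of_le hc] at ht
    nlinarith [ht.1]
  · intro t ht
    rw [uIcc_of_le (by linarith)] at ht
    nlinarith [ht.2]

namespace IsCantorLine

variable {r : ℝ} {M : Set ℝ}

theorem subset_Icc (hr : 2 < r) (hM : IsCantorLine r M) : M ⊆ Icc 0 1 := by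
  have hr0 : 0 < r := by linarith
  obtain ⟨a, ha, ha'⟩ := hM.isCompact.exists_isLeast hM.nonempty
  obtain ⟨b, hb, hb'⟩ := hM.isCompact.exists_isGreatest hM.nonempty
  have ha0 : 0 ≤ a := by
    obtain ⟨y, hy, h | h⟩ := hM.exists_preimage ha <;> rw [eq_div_iff hr0.ne'] at h <;>
      nlinarith [ha' hy]
  have hb1 : b ≤ 1 := by
    obtain ⟨y, hy, h | h⟩ := hM.exists_preimage hb <;> rw [eq_div_iff hr0.ne'] at h <;>
      nlinarith [hb' hy]
  exact fun x hx => ⟨ha0.trans (ha' hx), (hb' hx).trans hb1⟩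

theorem zero_mem (hr : 2 < r) (hM : IsCantorLine r M) : (0 : ℝ) ∈ M := by
  have hr0 : 0 < r := by linarith
  obtain ⟨a, ha, ha'⟩ := hM.isCompact.exists_isLeast hM.nonempty
  have h0 := (hM.subset_Icc hr ha).1
  have h := ha' (hM.left_mem ha)
  rw [le_div_iff₀ hr0] at h
  have : a = 0 := by nlinarith
  rwa [this] at ha

theorem one_mem (hr : 2 < r) (hM : IsCantorLine r M) : (1 : ℝ) ∈ M := by
  have hr0 : 0 < r := by linarith
  obtain ⟨b, hb, hb'⟩ := hM.isCompact.exists_isGreatest hM.nonempty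
  have h1 := (hM.subset_Icc hr hb).2
  have h := hb' (hM.right_mem hb)
  rw [div_le_iff₀ hr0] at h
  have : b = 1 := by nlinarith
  rwa [this] at hb

theorem one_div_mem (hr : 2 < r) (hM : IsCantorLine r M) : 1 / r ∈ M :=
  hM.left_mem (hM.one_mem hr)

theorem one_sub_one_div_mem (hr : 2 < r) (hM : IsCantorLine r M) : 1 - 1 / r ∈ M := by
  have hr0 : 0 < r := by linarith
  convert hM.right_mem (hM.zero_mem hr) using 1
  field_simp
  ring

theorem le_or_le_of_mem (hr : 2 < r) (hM : IsCantorLine r M) {x : ℝ} (hx : x ∈ M) :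
    x ≤ 1 / r ∨ 1 - 1 / r ≤ x := by
  have hr0 : 0 < r := by linarith
  obtain ⟨y, hy, rfl | rfl⟩ := hM.exists_preimage hx
  · exact .inl (div_le_div_of_nonneg_right (hM.subset_Icc hr hy).2 hr0.le)
  · right
    have := (hM.subset_Icc hr hy).1
    rw [le_div_iff₀ hr0, sub_mul, one_div_mul_cancel hr0.ne']
    linarith

theorem infDist_of_mem_Icc_half (hr : 2 < r) (hM : IsCantorLine r M) {x : ℝ}
    (hx : x ∈ Icc (1 / r) (1 / 2)) : infDist x M = x - 1 / r := by
  apply le_antisymm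
  · refine (infDist_le_dist_of_mem (hM.one_div_mem hr)).trans_eq ?_
    rw [Real.dist_eq, abs_of_nonneg (by linarith [hx.1])]
  · refine (le_infDist hM.nonempty).2 fun y hy => ?_
    rw [Real.dist_eq]
    rcases hM.le_or_le_of_mem hr hy with h | h
    · exact le_trans (by linarith) (le_abs_self _)
    · exact le_trans (by linarith [hx.1, hx.2]) (neg_le_abs _)

theorem infDist_of_half_mem_Icc (hr : 2 < r) (hM : IsCantorLine r M) {x : ℝ}
    (hx : x ∈ Icc (1 / 2) (1 - 1 / r)) : infDist x M = 1 - 1 / r - x := by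
  apply le_antisymm
  · refine (infDist_le_dist_of_mem (hM.one_sub_one_div_mem hr)).trans_eq ?_
    rw [Real.dist_eq, abs_of_nonpos (by linarith [hx.2])]
    ring
  · refine (le_infDist hM.nonempty).2 fun y hy => ?_
    rw [Real.dist_eq]
    rcases hM.le_or_le_of_mem hr hy with h | h
    · exact le_trans (by linarith [hx.1, hx.2]) (le_abs_self _)
    · exact le_trans (by linarith) (neg_le_abs _)

theorem infDist_div (hr : 2 < r) (hM : IsCantorLine r M) {y : ℝ} (hy : y ≤ 1) :
    infDist (y / r) M = infDist y M / r := by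
  have hr0 : 0 < r := by linarith
  have hscale := dist_div_div hr0
  apply le_antisymm
  · obtain ⟨m, hm, h⟩ := hM.isCompact.exists_infDist_eq_dist hM.nonempty y
    rw [h, ← hscale]
    exact infDist_le_dist_of_mem (hM.left_mem hm)
  · refine (le_infDist hM.nonempty).2 fun m hm => ?_
    obtain ⟨z, hz, rfl | rfl⟩ := hM.exists_preimage hm
    · rw [hscale]
      exact div_le_div_of_nonneg_right (infDist_le_dist_of_mem hz) hr0.le
    · rw [hscale]
      refine div_le_div_of_nonneg_right
        ((infDist_le_dist_of_mem (hM.one_mem hr)).trans ?_) hr0.le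
      have := (hM.subset_Icc hr hz).1
      rw [Real.dist_eq, Real.dist_eq, abs_of_nonpos (by linarith), abs_of_nonpos (by linarith)]
      linarith

theorem infDist_add_div (hr : 2 < r) (hM : IsCantorLine r M) {y : ℝ} (hy : 0 ≤ y) :
    infDist ((y + (r - 1)) / r) M = infDist y M / r := by
  have hr0 : 0 < r := by linarith
  have hscale := dist_div_div hr0
  apply le_antisymm
  · obtain ⟨m, hm, h⟩ := hM.isCompact.exists_infDist_eq_dist hM.nonempty y
    rw [h, ← dist_add_right y m (r - 1), ← hscale]
    exact infDist_le_dist_of_mem (hM.right_mem hm)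
  · refine (le_infDist hM.nonempty).2 fun m hm => ?_
    obtain ⟨z, hz, rfl | rfl⟩ := hM.exists_preimage hm
    · rw [hscale]
      refine div_le_div_of_nonneg_right
        ((infDist_le_dist_of_mem (hM.zero_mem hr)).trans ?_) hr0.le
      have := (hM.subset_Icc hr hz).2
      rw [Real.dist_eq, Real.dist_eq, abs_of_nonneg (by linarith), abs_of_nonneg (by linarith)]
      linarith
    · rw [hscale, dist_add_right]
      exact div_le_div_of_nonneg_right (infDist_le_dist_of_mem hz) hr0.le

theorem volume_gap_slice (hr : 2 < r) (hM : IsCantorLine r M) {δ : ℝ} (hδ : 0 ≤ δ)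
    (hδ' : δ < 1 / 2 - 1 / r) (y : ℝ) :
    volume {x | x ∈ Icc (1 / r) (1 - 1 / r) ∧ infDist x M ^ 2 + infDist y M ^ 2 ≤ δ ^ 2} =
      ENNReal.ofReal (2 * √(δ ^ 2 - infDist y M ^ 2)) := by
  set u := δ ^ 2 - infDist y M ^ 2 with hu
  have hset : {x | x ∈ Icc (1 / r) (1 - 1 / r) ∧ infDist x M ^ 2 + infDist y M ^ 2 ≤ δ ^ 2} =
      {x | x ∈ Icc (1 / r) (1 - 1 / r) ∧ infDist x M ^ 2 ≤ u} := by
    ext x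
    simp [hu, le_sub_iff_add_le]
  rw [hset]
  rcases lt_or_ge u 0 with h | h
  · rw [Real.sqrt_eq_zero_of_nonpos h.le, mul_zero, ENNReal.ofReal_zero]
    convert measure_empty (μ := volume)
    ext x
    simp only [mem_ofPred_eq, mem_empty_iff_false, iff_false, not_and, not_le]
    exact fun _ => h.trans_le (sq_nonneg _)
  · have hs : √u < 1 / 2 - 1 / r := by
      refine lt_of_le_of_lt ?_ hδ'
      rw [Real.sqrt_le_left hδ]
      linarith [sq_nonneg (infDist y M)]
    have h0 := Real.sqrt_nonneg u
    have hset' : {x | x ∈ Icc (1 / r) (1 - 1 / r) ∧ infDist x M ^ 2 ≤ u} =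
        Icc (1 / r) (1 / r + √u) ∪ Icc (1 - 1 / r - √u) (1 - 1 / r) := by
      ext x
      simp only [mem_ofPred_eq, mem_union, mem_Icc]
      rw [← Real.le_sqrt infDist_nonneg h]
      rcases le_total x (1 / 2) with hx | hx
      · constructor
        · rintro ⟨hx', h⟩
          rw [hM.infDist_of_mem_Icc_half hr ⟨hx'.1, hx⟩] at h
          exact .inl ⟨hx'.1, by linarith⟩
        · rintro (h | h)
          · rw [hM.infDist_of_mem_Icc_half hr ⟨h.1, hx⟩]
            exact ⟨⟨h.1, by linarith⟩, by linarith⟩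
          · exfalso; linarith
      · constructor
        · rintro ⟨hx', h⟩
          rw [hM.infDist_of_half_mem_Icc hr ⟨hx, hx'.2⟩] at h
          exact .inr ⟨by linarith, hx'.2⟩
        · rintro (h | h)
          · exfalso; linarith
          · rw [hM.infDist_of_half_mem_Icc hr ⟨hx, h.2⟩]
            exact ⟨⟨by linarith, h.2⟩, by linarith⟩
    rw [hset', measure_union _ measurableSet_Icc, Real.volume_Icc, Real.volume_Icc,
      ← ENNReal.ofReal_add (by linarith) (by linarith)]
    · congr 1
      ring
    · rw [Set.disjoint_left]
      intro x hx hx'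
      linarith [hx.2, hx'.1]

theorem volume_gap_prod (hr : 2 < r) (hM : IsCantorLine r M) {δ : ℝ} (hδ : 0 ≤ δ)
    (hδ' : δ < 1 / 2 - 1 / r) {J : Set ℝ} (hJ : MeasurableSet J) :
    volume {p : ℝ × ℝ | (p.1 ∈ Icc (1 / r) (1 - 1 / r) ∧ p.2 ∈ J) ∧
        infDist p.1 M ^ 2 + infDist p.2 M ^ 2 ≤ δ ^ 2} =
      ∫⁻ y in J, ENNReal.ofReal (2 * √(δ ^ 2 - infDist y M ^ 2)) := by
  have hmeas : MeasurableSet {p : ℝ × ℝ | (p.1 ∈ Icc (1 / r) (1 - 1 / r) ∧ p.2 ∈ J) ∧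
      infDist p.1 M ^ 2 + infDist p.2 M ^ 2 ≤ δ ^ 2} := by
    refine (measurableSet_Icc.prod hJ).inter (IsClosed.measurableSet ?_)
    have hc := continuous_infDist_pt M
    exact isClosed_le (f := fun p : ℝ × ℝ => infDist p.1 M ^ 2 + infDist p.2 M ^ 2)
      (by fun_prop) continuous_const
  rw [Measure.volume_eq_prod, Measure.prod_apply_symm hmeas, ← lintegral_indicator hJ]
  congr with y
  by_cases hy : y ∈ J
  · rw [indicator_of_mem hy, ← hM.volume_gap_slice hr hδ hδ']
    congr 1
    ext x
    simp [hy]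
  · rw [indicator_of_notMem hy]
    convert measure_empty (μ := volume)
    ext x
    simp [hy]

theorem toReal_volume_gap_prod (hr : 2 < r) (hM : IsCantorLine r M) {δ : ℝ} (hδ : 0 ≤ δ)
    (hδ' : δ < 1 / 2 - 1 / r) {J : Set ℝ} (hJ : MeasurableSet J) :
    (volume {p : ℝ × ℝ | (p.1 ∈ Icc (1 / r) (1 - 1 / r) ∧ p.2 ∈ J) ∧
        infDist p.1 M ^ 2 + infDist p.2 M ^ 2 ≤ δ ^ 2}).toReal =
      ∫ y in J, 2 * √(δ ^ 2 - infDist y M ^ 2) := by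
  have hc := continuous_infDist_pt M
  rw [hM.volume_gap_prod hr hδ hδ' hJ, integral_eq_lintegral_of_nonneg_ae]
  · exact Eventually.of_forall fun y => by positivity
  · exact Continuous.aestronglyMeasurable (by fun_prop)

theorem integral_gap (hr : 2 < r) (hM : IsCantorLine r M) {δ : ℝ} (hδ : 0 < δ)
    (hδ' : δ < 1 / 2 - 1 / r) :
    ∫ y in (1 / r)..(1 - 1 / r), 2 * √(δ ^ 2 - infDist y M ^ 2) = π * δ ^ 2 := by
  have hcd := continuous_infDist_pt M
  have hint : ∀ a b : ℝ, IntervalIntegrable (fun y => 2 * √(δ ^ 2 - infDist y M ^ 2)) volume a b :=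
    fun a b => Continuous.intervalIntegrable (by fun_prop) a b
  have hint' : ∀ a b : ℝ, IntervalIntegrable (fun t : ℝ => 2 * √(δ ^ 2 - t ^ 2)) volume a b :=
    fun a b => Continuous.intervalIntegrable (by fun_prop) a b
  have hl : ∫ y in (1 / r)..(1 / 2), 2 * √(δ ^ 2 - infDist y M ^ 2) =
      ∫ t in (0 : ℝ)..(1 / 2 - 1 / r), 2 * √(δ ^ 2 - t ^ 2) := by
    rw [← sub_self (1 / r),
      ← intervalIntegral.integral_comp_sub_right (fun t : ℝ => 2 * √(δ ^ 2 - t ^ 2)) (1 / r)]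
    refine intervalIntegral.integral_congr fun y hy => ?_
    rw [uIcc_of_le (by linarith)] at hy
    simp only [hM.infDist_of_mem_Icc_half hr hy]
  have hR : ∫ y in (1 / 2)..(1 - 1 / r), 2 * √(δ ^ 2 - infDist y M ^ 2) =
      ∫ t in (-(1 / 2 - 1 / r))..0, 2 * √(δ ^ 2 - t ^ 2) := by
    rw [show -(1 / 2 - 1 / r) = 1 / 2 - (1 - 1 / r) by ring, ← sub_self (1 - 1 / r),
      ← intervalIntegral.integral_comp_sub_right (fun t : ℝ => 2 * √(δ ^ 2 - t ^ 2)) (1 - 1 / r)]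
    refine intervalIntegral.integral_congr fun y hy => ?_
    rw [uIcc_of_le (by linarith)] at hy
    simp only [hM.infDist_of_half_mem_Icc hr hy]
    ring_nf
  rw [← intervalIntegral.integral_add_adjacent_intervals (hint _ (1 / 2)) (hint _ _), hl, hR,
    add_comm, intervalIntegral.integral_add_adjacent_intervals (hint' _ _) (hint' _ _),
    integral_sqrt_sq_sub_sq hδ hδ'.le]

theorem integral_unit_div (hr : 2 < r) (hM : IsCantorLine r M) {ε : ℝ} (hε : 0 < ε)
    (hε' : ε / r < 1 / 2 - 1 / r) :
    ∫ y in (0 : ℝ)..1, 2 * √((ε / r) ^ 2 - infDist y M ^ 2) =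
      2 / r ^ 2 * (∫ y in (0 : ℝ)..1, 2 * √(ε ^ 2 - infDist y M ^ 2)) + π * (ε / r) ^ 2 := by
  have hr0 : 0 < r := by linarith
  have hcd := continuous_infDist_pt M
  set F : ℝ → ℝ := fun y => 2 * √((ε / r) ^ 2 - infDist y M ^ 2) with hF
  have hint : ∀ a b : ℝ, IntervalIntegrable F volume a b :=
    fun a b => Continuous.intervalIntegrable (by fun_prop) a b
  have hscale : ∀ d : ℝ, 2 * √((ε / r) ^ 2 - (d / r) ^ 2) = r⁻¹ * (2 * √(ε ^ 2 - d ^ 2)) :=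
    fun d => by
      rw [div_pow, div_pow, ← sub_div, Real.sqrt_div' _ (sq_nonneg r), Real.sqrt_sq hr0.le]
      ring
  have hleft : ∫ y in (0 : ℝ)..(1 / r), F y =
      1 / r ^ 2 * ∫ y in (0 : ℝ)..1, 2 * √(ε ^ 2 - infDist y M ^ 2) := by
    have h := intervalIntegral.integral_comp_div F (a := 0) (b := 1) hr0.ne'
    rw [zero_div, smul_eq_mul] at h
    rw [← mul_right_inj' hr0.ne', ← h, intervalIntegral.integral_congr
      (g := fun y => r⁻¹ * (2 * √(ε ^ 2 - infDist y M ^ 2))),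
      intervalIntegral.integral_const_mul]
    · field_simp
    · intro y hy
      rw [uIcc_of_le zero_le_one] at hy
      simp only [hF, hM.infDist_div hr hy.2, hscale]
  have hright : ∫ y in (1 - 1 / r)..1, F y =
      1 / r ^ 2 * ∫ y in (0 : ℝ)..1, 2 * √(ε ^ 2 - infDist y M ^ 2) := by
    have h := intervalIntegral.integral_comp_div_add F (a := 0) (b := 1) hr0.ne' ((r - 1) / r)
    rw [zero_div, smul_eq_mul, show 0 + (r - 1) / r = 1 - 1 / r by field_simp; ring,
      show 1 / r + (r - 1) / r = 1 by field_simp; ring] at h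
    rw [← mul_right_inj' hr0.ne', ← h, intervalIntegral.integral_congr
      (g := fun y => r⁻¹ * (2 * √(ε ^ 2 - infDist y M ^ 2))),
      intervalIntegral.integral_const_mul]
    · field_simp
    · intro y hy
      rw [uIcc_of_le zero_le_one] at hy
      simp only [hF, ← add_div, hM.infDist_add_div hr hy.1, hscale]
  rw [← intervalIntegral.integral_add_adjacent_intervals (hint 0 (1 / r)) (hint _ _),
    ← intervalIntegral.integral_add_adjacent_intervals (hint (1 / r) (1 - 1 / r)) (hint _ _),
    hleft, hright, hM.integral_gap hr (by positivity) hε']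
  ring

end IsCantorLine

theorem volume_setOf_coords (P : ℝ × ℝ → Prop) :
    volume {p : EuclideanSpace ℝ (Fin 2) | P (p 0, p 1)} = volume {q : ℝ × ℝ | P q} :=
  MeasurePreserving.measure_preimage_equiv
    (f := (MeasurableEquiv.toLp 2 (Fin 2 → ℝ)).symm.trans MeasurableEquiv.finTwoArrow)
    ((volume_preserving_finTwoArrow ℝ).comp
      (EuclideanSpace.volume_preserving_symm_measurableEquiv_toLp (Fin 2)))
    {q : ℝ × ℝ | P q}

theorem toReal_volume_cthickening_inter_Gamma {r : ℝ} (hr : 2 < r) {M : Set ℝ}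
    (hM : IsCantorLine r M) {C : Set (EuclideanSpace ℝ (Fin 2))} (hC : IsCompact C)
    (h : ∀ p, p ∈ C ↔ p 0 ∈ M ∧ p 1 ∈ M) {δ : ℝ} (hδ : 0 < δ) (hδ' : δ < 1 / 2 - 1 / r) :
    (volume (cthickening δ C ∩ _root_.Gamma r)).toReal =
      2 * (∫ y in (0 : ℝ)..1, 2 * √(δ ^ 2 - infDist y M ^ 2)) - π * δ ^ 2 := by
  have hr0 : 0 < r := by linarith
  have hi : 0 < 1 / r := by positivity
  set G := Icc (1 / r) (1 - 1 / r)
  set I : Set ℝ := Ioo 0 1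
  have hGI : G ⊆ I := Icc_subset_Ioo hi (by linarith)
  set E : ℝ × ℝ → Prop := fun p => infDist p.1 M ^ 2 + infDist p.2 M ^ 2 ≤ δ ^ 2 with hE
  set A : Set (ℝ × ℝ) := {p | (p.1 ∈ G ∧ p.2 ∈ I) ∧ E p} with hA
  set B : Set (ℝ × ℝ) := {p | (p.2 ∈ G ∧ p.1 ∈ I) ∧ E p} with hB
  have hcd := continuous_infDist_pt M
  have hEm : MeasurableSet {p | E p} :=
    (isClosed_le (by fun_prop) continuous_const).measurableSet
  have hBm : MeasurableSet B :=
    ((measurable_snd measurableSet_Icc).inter (measurable_fst measurableSet_Ioo)).inter hEm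
  have hset : cthickening δ C ∩ _root_.Gamma r =
      {p : EuclideanSpace ℝ (Fin 2) | (p 0, p 1) ∈ A ∪ B} := by
    ext p
    rw [mem_inter_iff, mem_Gamma_iff hr,
      mem_cthickening_of_forall_mem_iff hM.isCompact hM.nonempty hC h hδ.le]
    simp only [hA, hB, hE, mem_ofPred_eq, mem_union]
    tauto
  have hvA : (volume A).toReal = ∫ y in (0 : ℝ)..1, 2 * √(δ ^ 2 - infDist y M ^ 2) := by
    rw [hM.toReal_volume_gap_prod hr hδ.le hδ' measurableSet_Ioo,
      intervalIntegral.integral_of_le zero_le_one, integral_Ioc_eq_integral_Ioo]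
  have hBA : volume B = volume A := by
    have hswap : B = Prod.swap ⁻¹' A := by
      ext p
      simp [hA, hB, hE, add_comm]
    rw [hswap, Measure.volume_eq_prod]
    exact MeasurePreserving.measure_preimage_equiv (f := MeasurableEquiv.prodComm)
      Measure.measurePreserving_swap A
  have hAB : (volume (A ∩ B)).toReal = π * δ ^ 2 := by
    have : A ∩ B = {p | (p.1 ∈ G ∧ p.2 ∈ G) ∧ E p} := by
      ext p
      simp only [hA, hB, mem_inter_iff, mem_ofPred_eq]
      exact ⟨fun ⟨a, b⟩ => ⟨⟨a.1.1, b.1.1⟩, a.2⟩,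
        fun ⟨⟨a, b⟩, c⟩ => ⟨⟨⟨a, hGI b⟩, c⟩, ⟨b, hGI a⟩, c⟩⟩
    rw [this, hM.toReal_volume_gap_prod hr hδ.le hδ' measurableSet_Icc,
      ← hM.integral_gap hr hδ hδ', intervalIntegral.integral_of_le (by linarith),
      integral_Icc_eq_integral_Ioc]
  have hfin : volume A ≠ ∞ := by
    refine ne_top_of_le_ne_top ?_ (measure_mono (t := Icc (0 : ℝ) 1 ×ˢ Icc (0 : ℝ) 1) ?_)
    · exact (isCompact_Icc.prod isCompact_Icc).measure_lt_top.ne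
    · exact fun p hp => ⟨Ioo_subset_Icc_self (hGI hp.1.1), Ioo_subset_Icc_self hp.1.2⟩
  have hsum := congrArg ENNReal.toReal (measure_union_add_inter (μ := volume) A hBm)
  rw [hBA, ENNReal.toReal_add (measure_union_ne_top hfin (hBA ▸ hfin))
    (measure_inter_ne_top_of_left_ne_top hfin), ENNReal.toReal_add hfin hfin, hvA, hAB] at hsum
  rw [hset, volume_setOf_coords (fun q => q ∈ A ∪ B)]
  change (volume (A ∪ B)).toReal = _
  linarith

/-- For `r > 2` and `0 < ε < (r-2)/(2r)`, the recursion
`λ²((C^r)_{ε/r} ∩ Γ) = (2/r²)·λ²((C^r)_ε ∩ Γ) + (3π/r²)·ε²` holds. -/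
theorem stmt_2 (r : ℝ) (hr : 2 < r) (C : Set (EuclideanSpace ℝ (Fin 2)))
    (hC : IsCantorDust r C) (ε : ℝ) (hε : 0 < ε) (hε' : ε < (r - 2) / (2 * r)) :
    (volume (cthickening (ε / r) C ∩ Gamma r)).toReal =
      2 / r ^ 2 * (volume (cthickening ε C ∩ Gamma r)).toReal + 3 * π / r ^ 2 * ε ^ 2 := by
  have hr0 : 0 < r := by linarith
  have hgap : (r - 2) / (2 * r) = 1 / 2 - 1 / r := by field_simp
  rw [hgap] at hε'
  have hdiv : ε / r < 1 / 2 - 1 / r := (div_le_self hε.le (by linarith)).trans_lt hε'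
  obtain ⟨M, hM, hCM⟩ := hC.exists_cantorLine hr
  rw [toReal_volume_cthickening_inter_Gamma hr hM hC.1 hCM (by positivity) hdiv,
    toReal_volume_cthickening_inter_Gamma hr hM hC.1 hCM hε hε', hM.integral_unit_div hr hε hdiv]
  ring
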